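/- arXiv:0904.0798 — 2 statements merged into one kernel-verified Lean document; each statement's English description precedes it below -/
import Mathlib

section
/- Let n be a positive integer and let V, χ : ℝ → ℝ be functions with χ(s) ≥ 0 for all s, that are differentiable on [r₀, r] with continuous derivatives there, where √(2(n+2)) < r₀ < r, and that satisfy n·V(s) − s·V'(s) = 2·χ(s) − (4/s)·χ'(s) for every s ∈ [r₀, r]. Then V(r)/rⁿ − V(r₀)/r₀ⁿ ≤ 4·χ(r)/r^{n+2}. -/
/-- The derivative of `V(s)/sⁿ − 4·χ(s)/s^(n+2)` under the identity
`n·V − s·V' = 2·χ − (4/s)·χ'`. -/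
theorem hasDerivAt_div_pow_sub_div_pow {V χ : ℝ → ℝ} {v c s : ℝ} {n : ℕ} (hn : 0 < n)
    (hs : 0 < s) (hV : HasDerivAt V v s) (hχ : HasDerivAt χ c s)
    (hid : (n : ℝ) * V s - s * v = 2 * χ s - (4 / s) * c) :
    HasDerivAt (fun x => V x / x ^ n - 4 * χ x / x ^ (n + 2))
      (χ s * (4 * ((n : ℝ) + 2) - 2 * s ^ 2) / s ^ (n + 3)) s := by
  obtain ⟨m, rfl⟩ := Nat.exists_eq_succ_of_ne_zero hn.ne'
  have hs' := hs.ne'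
  have hv : v = (((m.succ : ℕ) : ℝ) * V s - 2 * χ s + (4 / s) * c) / s := by
    rw [eq_div_iff hs']
    linarith
  refine ((hV.div (hasDerivAt_pow m.succ s) (pow_ne_zero _ hs')).sub
    ((hχ.const_mul 4).div (hasDerivAt_pow (m.succ + 2) s) (pow_ne_zero _ hs'))).congr_deriv ?_
  rw [hv]
  simp only [Nat.succ_eq_add_one, Nat.add_sub_cancel, Nat.cast_add, Nat.cast_one,
    Nat.cast_ofNat, show m + 1 + 2 - 1 = m + 2 from rfl]
  field_simp
  ring

/-- Inequality (1) of the paper: if `χ ≥ 0` and the differential identity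
`n·V(s) − s·V'(s) = 2·χ(s) − (4/s)·χ'(s)` holds on `[r₀, r]` with
`√(2(n+2)) < r₀ < r`, then `V(r)/rⁿ − V(r₀)/r₀ⁿ ≤ 4·χ(r)/r^(n+2)`. -/
theorem volume_ratio_inequality
    (n : ℕ) (hn : 0 < n) (r₀ r : ℝ)
    (hr₀ : Real.sqrt (2 * ((n : ℝ) + 2)) < r₀) (hr : r₀ < r)
    (V χ V' χ' : ℝ → ℝ)
    (hχnonneg : ∀ s, 0 ≤ χ s)
    (hV : ∀ s ∈ Set.Icc r₀ r, HasDerivAt V (V' s) s)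
    (hχ : ∀ s ∈ Set.Icc r₀ r, HasDerivAt χ (χ' s) s)
    (hV' : ContinuousOn V' (Set.Icc r₀ r))
    (hχ' : ContinuousOn χ' (Set.Icc r₀ r))
    (hid : ∀ s ∈ Set.Icc r₀ r,
      (n : ℝ) * V s - s * V' s = 2 * χ s - (4 / s) * χ' s) :
    V r / r ^ n - V r₀ / r₀ ^ n ≤ 4 * χ r / r ^ (n + 2) := by
  have hpos : 0 < r₀ := (Real.sqrt_nonneg _).trans_lt hr₀
  have hsq : 2 * ((n : ℝ) + 2) < r₀ ^ 2 := (Real.sqrt_lt' hpos).1 hr₀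
  have hderiv : ∀ s ∈ Set.Icc r₀ r,
      HasDerivAt (fun x => V x / x ^ n - 4 * χ x / x ^ (n + 2))
        (χ s * (4 * ((n : ℝ) + 2) - 2 * s ^ 2) / s ^ (n + 3)) s := fun s hs =>
    hasDerivAt_div_pow_sub_div_pow hn (hpos.trans_le hs.1) (hV s hs) (hχ s hs) (hid s hs)
  have hanti : AntitoneOn (fun x => V x / x ^ n - 4 * χ x / x ^ (n + 2)) (Set.Icc r₀ r) := by
    refine antitoneOn_of_hasDerivWithinAt_nonpos (convex_Icc r₀ r)
      (fun s hs => (hderiv s hs).continuousAt.continuousWithinAt)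
      (fun s hs => (hderiv s (interior_subset hs)).hasDerivWithinAt) fun s hs => ?_
    have hs₀ : r₀ ≤ s := (interior_subset hs).1
    have hs₁ : r₀ ^ 2 ≤ s ^ 2 := pow_le_pow_left₀ hpos.le hs₀ 2
    exact div_nonpos_of_nonpos_of_nonneg
      (mul_nonpos_of_nonneg_of_nonpos (hχnonneg s) (by linarith))
      (pow_nonneg (hpos.le.trans hs₀) _)
  have hle := hanti (Set.left_mem_Icc.2 hr.le) (Set.right_mem_Icc.2 hr.le) hr.le
  have hχ₀ : 0 ≤ 4 * χ r₀ / r₀ ^ (n + 2) :=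
    div_nonneg (mul_nonneg zero_le_four (hχnonneg r₀)) (pow_nonneg hpos.le _)
  dsimp only at hle
  linarith
end

section
/- Let n be a positive integer and let V, χ : ℝ → ℝ be functions, differentiable with continuous derivative on (0, ∞), such that for all s > 0: (i) V(s) ≥ 0, (ii) 0 ≤ χ(s) ≤ (n/2)·V(s), and (iii) n·V(s) − s·V'(s) = 2·χ(s) − (4/s)·χ'(s). Then there exist constants C > 0 and δ > 0 such that V(r) ≤ C·rⁿ for all r ≥ δ. -/
/-- The monotone quantity `(s² V - 4 χ) / s ^ (n + 2) = V / s ^ n - 4 χ / s ^ (n + 2)` has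
derivative `χ (4 (n + 2) - 2 s²) / s ^ (n + 3)`. -/
theorem hasDerivAt_normalized_volume {n : ℕ} {V χ : ℝ → ℝ} {v c s : ℝ} (hs : 0 < s)
    (hV : HasDerivAt V v s) (hχ : HasDerivAt χ c s)
    (hid : (n : ℝ) * V s - s * v = 2 * χ s - (4 / s) * c) :
    HasDerivAt (fun t => (t ^ 2 * V t - 4 * χ t) / t ^ (n + 2))
      (χ s * (4 * (n + 2) - 2 * s ^ 2) / s ^ (n + 3)) s := by
  have h := (((hasDerivAt_pow 2 s).mul hV).sub (hχ.const_mul 4)).div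
    (hasDerivAt_pow (n + 2) s) (by positivity)
  refine h.congr_deriv ?_
  have hc : c = s * (2 * χ s - n * V s + s * v) / 4 := by
    field_simp at hid
    linarith
  simp only [Pi.mul_apply, Pi.sub_apply, hc,
    show n + 2 - 1 = n + 1 from rfl]
  push_cast
  field_simp
  ring

/-- Analytic core of the main theorem: if `V, χ` are differentiable with continuous
derivatives on `(0, ∞)`, `V ≥ 0`, `0 ≤ χ ≤ (n/2)·V`, and
`n·V(s) − s·V'(s) = 2·χ(s) − (4/s)·χ'(s)` for all `s > 0`, then there exist `C > 0`
and `δ > 0` with `V(r) ≤ C·rⁿ` for all `r ≥ δ`. -/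
theorem volume_growth_euclidean
    (n : ℕ) (hn : 0 < n) (V χ V' χ' : ℝ → ℝ)
    (hV : ∀ s ∈ Set.Ioi (0 : ℝ), HasDerivAt V (V' s) s)
    (hχ : ∀ s ∈ Set.Ioi (0 : ℝ), HasDerivAt χ (χ' s) s)
    (hV' : ContinuousOn V' (Set.Ioi (0 : ℝ)))
    (hχ' : ContinuousOn χ' (Set.Ioi (0 : ℝ)))
    (hVnonneg : ∀ s ∈ Set.Ioi (0 : ℝ), 0 ≤ V s)
    (hχnonneg : ∀ s ∈ Set.Ioi (0 : ℝ), 0 ≤ χ s)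
    (hχle : ∀ s ∈ Set.Ioi (0 : ℝ), χ s ≤ (n : ℝ) / 2 * V s)
    (hid : ∀ s ∈ Set.Ioi (0 : ℝ),
      (n : ℝ) * V s - s * V' s = 2 * χ s - (4 / s) * χ' s) :
    ∃ C > (0 : ℝ), ∃ δ > (0 : ℝ), ∀ r ≥ δ, V r ≤ C * r ^ n := by
  have hδ : (0 : ℝ) < 2 * (n + 2) := by positivity
  set δ : ℝ := 2 * (n + 2)
  set G : ℝ → ℝ := fun t => (t ^ 2 * V t - 4 * χ t) / t ^ (n + 2) with hG
  have hn0 : (0 : ℝ) ≤ n := n.cast_nonneg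
  have hderiv : ∀ s, 0 < s →
      HasDerivAt G (χ s * (4 * (n + 2) - 2 * s ^ 2) / s ^ (n + 3)) s := fun s hs =>
    hasDerivAt_normalized_volume hs (hV s hs) (hχ s hs) (hid s hs)
  have hanti : AntitoneOn G (Set.Ici δ) := by
    refine antitoneOn_of_hasDerivWithinAt_nonpos (convex_Ici δ)
      (fun s hs => (hderiv s (hδ.trans_le hs)).continuousAt.continuousWithinAt)
      (fun s hs => (hderiv s (hδ.trans_le (interior_subset hs))).hasDerivWithinAt)
      fun s hs => ?_
    have hs' : δ ≤ s := interior_subset hs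
    have hs0 : 0 < s := hδ.trans_le hs'
    refine div_nonpos_of_nonpos_of_nonneg
      (mul_nonpos_of_nonneg_of_nonpos (hχnonneg s hs0) ?_) (by positivity)
    nlinarith
  refine ⟨2 * |G δ| + 1, by positivity, δ, hδ, fun r hr => ?_⟩
  have hr0 : 0 < r := hδ.trans_le hr
  have hGr : G r ≤ |G δ| :=
    (hanti Set.self_mem_Ici hr hr).trans (le_abs_self _)
  rw [hG, div_le_iff₀ (by positivity), ← hG] at hGr
  have hχr := hχle r hr0
  have hVr := hVnonneg r hr0
  have hrn : 4 * (n : ℝ) ≤ r ^ 2 := by nlinarith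
  have hmul : r ^ 2 * V r ≤ r ^ 2 * (2 * |G δ| * r ^ n) := by
    have := mul_le_mul_of_nonneg_right hrn hVr
    rw [pow_add] at hGr
    linarith
  have hle := le_of_mul_le_mul_left hmul (by positivity)
  have hpow : 0 ≤ r ^ n := by positivity
  linarith
end
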